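/- arXiv:math/0311135 — 2 statements merged into one kernel-verified Lean document; each statement's English description precedes it below -/
import Mathlib

section
/- Suppose B, C ⊆ ω^ω are Borel sets, neither of which is contained in a countable union of compact subsets of ω^ω, and suppose B × C ⊆ ⋃ₙ Aₙ where each Aₙ ⊆ ω^ω × ω^ω is Borel. Then there exist an index n and Borel sets B' ⊆ B and C' ⊆ C, neither contained in a countable union of compact sets, such that B' × C' ⊆ Aₙ. (Spinas: MRR(I, I) holds for the Miller ideal I.) -/
/-- A set of Baire space is Miller-positive if it is not contained in any
countable union of compact subsets of `ω^ω`. -/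
def MillerPositive (B : Set (ℕ → ℕ)) : Prop :=
  ¬ ∃ K : ℕ → Set (ℕ → ℕ), (∀ n, IsCompact (K n)) ∧ B ⊆ ⋃ n, K n

open Set Filter PiNat

section Miller

theorem exists_bound_of_isCompact {K : Set (ℕ → ℕ)} (hK : IsCompact K) :
    ∃ h : ℕ → ℕ, ∀ x ∈ K, ∀ n, x n ≤ h n := by
  have h1 : ∀ n : ℕ, ∃ b, ∀ x ∈ K, x n ≤ b := by
    intro n
    obtain ⟨b, hb⟩ := (hK.image (continuous_apply n)).bddAbove
    exact ⟨b, fun x hx => hb ⟨x, hx, rfl⟩⟩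
  choose h hh using h1
  exact ⟨h, fun x hx n => hh n x hx⟩

theorem isCompact_le (h : ℕ → ℕ) : IsCompact {x : ℕ → ℕ | ∀ n, x n ≤ h n} := by
  have : {x : ℕ → ℕ | ∀ n, x n ≤ h n} = Set.pi univ fun n => Iic (h n) := by
    ext x; simp [Pi.le_def]
  rw [this]
  exact isCompact_univ_pi fun n => (finite_Iic _).isCompact

theorem millerPositive_univ : MillerPositive univ := by
  rintro ⟨K, hK, hsub⟩
  choose h hh using fun n => exists_bound_of_isCompact (hK n)
  obtain ⟨n, hn⟩ := mem_iUnion.1 (hsub (mem_univ fun n => h n n + 1))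
  exact absurd (hh n _ hn n) (by simp)

theorem MillerPositive.mono {B C : Set (ℕ → ℕ)} (hB : MillerPositive B) (h : B ⊆ C) :
    MillerPositive C :=
  fun ⟨K, hK, hC⟩ => hB ⟨K, hK, h.trans hC⟩

theorem not_millerPositive_iUnion {ι : Type*} [Countable ι] {B : ι → Set (ℕ → ℕ)}
    (hB : ∀ i, ¬ MillerPositive (B i)) : ¬ MillerPositive (⋃ i, B i) := by
  simp only [MillerPositive, not_not] at hB ⊢
  choose K hK hsub using hB
  rcases isEmpty_or_nonempty ι with hι | hι
  · exact ⟨fun _ => ∅, fun _ => isCompact_empty, by simp⟩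
  · obtain ⟨e, he⟩ := exists_surjective_nat (ι × ℕ)
    refine ⟨fun n => K (e n).1 (e n).2, fun n => hK _ _, ?_⟩
    intro x hx
    obtain ⟨i, hi⟩ := mem_iUnion.1 hx
    obtain ⟨j, hj⟩ := mem_iUnion.1 (hsub i hi)
    obtain ⟨n, hn⟩ := he (i, j)
    exact mem_iUnion.2 ⟨n, by simpa [hn] using hj⟩

/-- A positive set is unbounded in some coordinate. -/
theorem MillerPositive.exists_strictMono {B : Set (ℕ → ℕ)} (hB : MillerPositive B) :
    ∃ m, ∃ v : ℕ → ℕ, StrictMono v ∧ ∀ k, ∃ x ∈ B, x m = v k := by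
  by_contra! hcon
  refine hB ?_
  have hfin : ∀ m, ((fun x : ℕ → ℕ => x m) '' B).Finite := by
    intro m
    by_contra hinf
    obtain ⟨k, hk⟩ := hcon m _ (Nat.nth_strictMono (p := (· ∈ (fun x : ℕ → ℕ => x m) '' B)) hinf)
    obtain ⟨x, hx, hxk⟩ := Nat.nth_mem_of_infinite
      (p := (· ∈ (fun x : ℕ → ℕ => x m) '' B)) hinf k
    exact hk x hx hxk
  choose h hh using fun m => (hfin m).bddAbove
  refine ⟨fun _ => {x | ∀ n, x n ≤ h n}, fun _ => isCompact_le h, fun x hx => ?_⟩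
  exact mem_iUnion.2 ⟨0, fun n => hh n ⟨x, hx, rfl⟩⟩

theorem continuous_of_res {α : Type*} [TopologicalSpace α] {S : Type*} [TopologicalSpace S]
    [DiscreteTopology S] (n : ℕ) {F : (ℕ → S) → α}
    (hF : ∀ g g', res g n = res g' n → F g = F g') : Continuous F := by
  refine IsLocallyConstant.continuous ((IsLocallyConstant.iff_exists_open F).2 fun g => ?_)
  refine ⟨cylinder g n, isOpen_cylinder _ g n, self_mem_cylinder g n, fun g' hg' => hF _ _ ?_⟩
  rw [cylinder_eq_res] at hg'
  exact hg'

/-- The map `f` parametrizes a superperfect set: the coordinate `pos (res g n)` of `f g`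
is a strictly increasing function of `g n`. -/
structure IsSplitting (f : (ℕ → ℕ) → ℕ → ℕ) : Prop where
  continuous : Continuous f
  exists_pos_val : ∃ (pos : List ℕ → ℕ) (val : List ℕ → ℕ → ℕ), (∀ l, StrictMono (val l)) ∧
    ∀ g n, f g (pos (res g n)) = val (res g n) (g n)

theorem IsSplitting.injective {f : (ℕ → ℕ) → ℕ → ℕ} (hf : IsSplitting f) :
    Function.Injective f := by
  obtain ⟨pos, val, hval, hpv⟩ := hf.exists_pos_val
  intro g g' h
  have key : ∀ n, res g n = res g' n := by
    intro n
    induction n with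
    | zero => rfl
    | succ n ih =>
      have h1 := hpv g n
      rw [h, ih, hpv g' n] at h1
      rw [res_succ, res_succ, ih, (hval _).injective h1]
  funext n
  exact res_eq_res.1 (key (n + 1)) n.lt_succ_self

theorem IsSplitting.isCompact_preimage {f : (ℕ → ℕ) → ℕ → ℕ} (hf : IsSplitting f)
    {K : Set (ℕ → ℕ)} (hK : IsCompact K) : IsCompact (f ⁻¹' K) := by
  obtain ⟨pos, val, hval, hpv⟩ := hf.exists_pos_val
  obtain ⟨h, hh⟩ := exists_bound_of_isCompact hK
  have key : ∀ n, ((fun g => res g n) '' (f ⁻¹' K)).Finite := by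
    intro n
    induction n with
    | zero => exact (finite_singleton []).subset (by rintro _ ⟨g, -, rfl⟩; simp)
    | succ n ih =>
      refine (ih.biUnion fun l _ => (finite_Iic (h (pos l))).image (· :: l)).subset ?_
      rintro _ ⟨g, hg, rfl⟩
      refine mem_iUnion₂.2 ⟨res g n, ⟨g, hg, rfl⟩, g n, ?_, (res_succ g n).symm⟩
      have := (hval (res g n)).le_apply (x := g n)
      rw [← hpv] at this
      exact this.trans (hh _ hg _)
  have hcl : IsClosed (f ⁻¹' K) := hK.isClosed.preimage hf.continuous
  choose b hb using fun n => ((key (n + 1)).image List.headI).bddAbove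
  refine (isCompact_le b).of_isClosed_subset hcl fun g hg n => ?_
  exact hb n ⟨_, ⟨g, hg, rfl⟩, by simp [res_succ]⟩

theorem millerPositive_range {f : (ℕ → ℕ) → ℕ → ℕ}
    (hf : ∀ K, IsCompact K → IsCompact (f ⁻¹' K)) : MillerPositive (range f) := by
  rintro ⟨K, hK, hsub⟩
  refine millerPositive_univ ⟨fun n => f ⁻¹' K n, fun n => hf _ (hK n), fun g _ => ?_⟩
  rw [← preimage_iUnion]
  exact hsub (mem_range_self g)

/-- Kechris, Saint Raymond: an analytic Miller-positive set contains a closed copy of the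
Baire space. -/
theorem MillerPositive.exists_isSplitting {B : Set (ℕ → ℕ)} (hB : MillerPositive B)
    (hBan : MeasureTheory.AnalyticSet B) : ∃ f, IsSplitting f ∧ range f ⊆ B := by
  rw [MeasureTheory.AnalyticSet] at hBan
  rcases hBan with rfl | ⟨f, hf, rfl⟩
  · exact absurd ⟨fun _ => ∅, fun _ => isCompact_empty, by simp⟩ hB
  set X : Set (ℕ → ℕ) := {z | ∀ n, MillerPositive (f '' cylinder z n)} with hX
  have hXc : ¬ MillerPositive (f '' Xᶜ) := by
    let I := {l : List ℕ // ¬ MillerPositive (f '' {z | res z l.length = l})}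
    have : f '' Xᶜ ⊆ ⋃ i : I, f '' {z | res z i.1.length = i.1} := by
      rintro _ ⟨z, hz, rfl⟩
      simp only [hX, mem_compl_iff, mem_ofPred_eq, not_forall] at hz
      obtain ⟨n, hn⟩ := hz
      rw [cylinder_eq_res] at hn
      refine mem_iUnion.2 ⟨⟨res z n, by simpa using hn⟩, z, by simp, rfl⟩
    exact fun h => not_millerPositive_iUnion (fun i : I => i.2) (h.mono this)
  have hpos : ∀ s : Set (ℕ → ℕ), MillerPositive (f '' s) → MillerPositive (f '' (s ∩ X)) := by
    intro s hs
    by_contra hcon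
    refine not_millerPositive_iUnion (B := fun b : Bool => cond b (f '' (s ∩ X)) (f '' Xᶜ))
      (by rintro (_ | _) <;> assumption) (hs.mono ?_)
    rintro _ ⟨z, hz, rfl⟩
    by_cases hzX : z ∈ X
    · exact mem_iUnion.2 ⟨true, z, ⟨hz, hzX⟩, rfl⟩
    · exact mem_iUnion.2 ⟨false, z, hzX, rfl⟩
  have hchild : ∀ p : X × ℕ, ∃ (m : ℕ) (v : ℕ → ℕ) (c : ℕ → X × ℕ), StrictMono v ∧
      ∀ k, (c k).1.1 ∈ cylinder p.1.1 p.2 ∧ p.2 < (c k).2 ∧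
        ∀ z ∈ cylinder (c k).1.1 (c k).2, f z m = v k := by
    rintro ⟨⟨z, hz⟩, n⟩
    obtain ⟨m, v, hv, hx⟩ := (hpos _ (hz n)).exists_strictMono
    have : ∀ k, ∃ c : X × ℕ, c.1.1 ∈ cylinder z n ∧ n < c.2 ∧
        ∀ z' ∈ cylinder c.1.1 c.2, f z' m = v k := by
      intro k
      obtain ⟨_, ⟨y, ⟨hyc, hyX⟩, rfl⟩, hy⟩ := hx k
      have hopen : IsOpen {z' | f z' m = v k} :=
        (isOpen_discrete {v k}).preimage ((continuous_apply m).comp hf)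
      obtain ⟨_, ⟨y', N, rfl⟩, hyN, hN⟩ :=
        (isTopologicalBasis_cylinders _).exists_subset_of_mem_open hy hopen
      refine ⟨(⟨y, hyX⟩, max N (n + 1)), hyc, by simp, fun z' hz' => hN ?_⟩
      rw [← mem_cylinder_iff_eq.1 hyN]
      exact cylinder_anti _ (le_max_left _ _) hz'
    choose c hc using this
    exact ⟨m, v, c, hv, hc⟩
  have hXne : X.Nonempty := by
    have := hpos univ (by rwa [image_univ])
    by_contra hne
    rw [not_nonempty_iff_eq_empty.1 hne] at this
    exact this ⟨fun _ => ∅, fun _ => isCompact_empty, by simp⟩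
  obtain ⟨z₀, hz₀⟩ := hXne
  choose m v c hv hc using hchild
  let node : List ℕ → X × ℕ := fun l => l.rec (⟨z₀, hz₀⟩, 0) fun k _ p => c p k
  have node_cons : ∀ k l, node (k :: l) = c (node l) k := fun _ _ => rfl
  let C : (ℕ → ℕ) → ℕ → Set (ℕ → ℕ) :=
    fun g n => cylinder (node (res g n)).1.1 (node (res g n)).2
  have hle : ∀ g n, n ≤ (node (res g n)).2 := by
    intro g n
    induction n with
    | zero => simp
    | succ n ih => rw [res_succ, node_cons]; exact ih.trans_lt (hc _ _).2.1
  have hanti : ∀ g, Antitone (C g) := by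
    refine fun g => antitone_nat_of_succ_le fun n => ?_
    simp only [C, res_succ, node_cons]
    obtain ⟨h1, h2, -⟩ := hc (node (res g n)) (g n)
    rw [← mem_cylinder_iff_eq.1 h1]
    exact cylinder_anti _ h2.le
  have hself : ∀ g n j, n ≤ j → (node (res g j)).1.1 ∈ C g n :=
    fun g n j h => hanti g h (self_mem_cylinder _ _)
  let w : (ℕ → ℕ) → ℕ → ℕ := fun g i => (node (res g (i + 1))).1.1 i
  have hw : ∀ g n, w g ∈ C g n := by
    intro g n i hi
    rcases le_total n (i + 1) with h | h
    · exact hself g n (i + 1) h i hi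
    · exact (hself g (i + 1) n h i (hle g (i + 1))).symm
  have hwc : Continuous w := continuous_pi fun i =>
    continuous_of_res (i + 1) fun g g' h => by simp only [w, h]
  refine ⟨f ∘ w, ⟨hf.comp hwc, fun l => m (node l), fun l => v (node l), fun l => hv _, ?_⟩,
    range_comp_subset_range _ _⟩
  intro g n
  refine (hc (node (res g n)) (g n)).2.2 _ ?_
  have := hw g (n + 1)
  simpa only [C, res_succ, node_cons] using this

end Miller

section Ramsey

variable {S : Type*} {U : Ultrafilter S}

/-- The branches extending `t` of the tree whose nodes `l` (beyond `t`, listed in reverse) have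
successor sets `F l`. -/
def branches (F : List S → Set S) (t : List S) : Set (ℕ → S) :=
  {z | res z t.length = t ∧ ∀ n, t.length ≤ n → z n ∈ F (res z n)}

theorem branches_mono {F F' : List S → Set S} (h : ∀ l, F l ⊆ F' l) (t : List S) :
    branches F t ⊆ branches F' t :=
  fun _ hz => ⟨hz.1, fun n hn => h _ (hz.2 n hn)⟩

theorem mem_branches_res {F : List S → Set S} {z : ℕ → S} {N : ℕ}
    (h : ∀ n, N ≤ n → z n ∈ F (res z n)) : z ∈ branches F (res z N) := by
  refine ⟨by simp, fun n hn => h n (by simpa using hn)⟩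

theorem res_suffix_res (z : ℕ → S) {m n : ℕ} (h : m ≤ n) : res z m <:+ res z n := by
  induction n, h using Nat.le_induction with
  | base => exact List.suffix_rfl
  | succ n _ ih => exact ih.trans (by rw [res_succ]; exact List.suffix_cons _ _)

theorem exists_mem_branches (F : List S → Set S) (hF : ∀ l, (F l).Nonempty) :
    ∃ z, z ∈ branches F [] := by
  choose c hc using hF
  let node : ℕ → List S := fun n => n.rec [] fun _ l => c l :: l
  have h : ∀ n, res (fun n => c (node n)) n = node n := by
    intro n
    induction n with
    | zero => rfl
    | succ n ih => rw [res_succ, ih]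
  exact ⟨fun n => c (node n), rfl, fun n _ => by rw [h]; exact hc _⟩

/-- Diagonal intersection of trees. -/
theorem exists_branches_subset {Fam : List S → List S → Set S} (hFam : ∀ t l, Fam t l ∈ U) :
    ∃ F : List S → Set S, (∀ l, F l ∈ U) ∧ ∀ t, branches F t ⊆ branches (Fam t) t := by
  refine ⟨fun l => ⋂ t ∈ {t | t <:+ l}, Fam t l, fun l => ?_, fun t z hz => ⟨hz.1, ?_⟩⟩
  · have hfin : {t | t <:+ l}.Finite := by
      refine (List.finite_toSet l.tails).subset fun t ht => ?_
      simpa using ht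
    exact (biInter_mem hfin).2 fun t _ => hFam t l
  · intro n hn
    refine mem_iInter₂.1 (hz.2 n hn) t ?_
    have := res_suffix_res z hn
    rwa [hz.1] at this

theorem exists_forall_eventually {F : ℕ → List S → Set S} (hF : ∀ i l, F i l ∈ U) :
    ∃ F' : List S → Set S, (∀ l, F' l ∈ U) ∧ ∀ l, ∀ i ≤ l.length, F' l ⊆ F i l := by
  refine ⟨fun l => ⋂ i ∈ Iic l.length, F i l, fun l => ?_, fun l i hi => ?_⟩
  · exact (biInter_mem (finite_Iic _)).2 fun i _ => hF i l
  · exact biInter_subset_of_mem hi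

/-- Every finite sequence is the stem of a `U`-tree deciding `X`. -/
def IsDecided (U : Ultrafilter S) (X : Set (ℕ → S)) : Prop :=
  ∃ F : List S → Set S, (∀ l, F l ∈ U) ∧ ∀ t, branches F t ⊆ X ∨ branches F t ⊆ Xᶜ

theorem IsDecided.compl {X : Set (ℕ → S)} (h : IsDecided U X) : IsDecided U Xᶜ := by
  obtain ⟨F, hF, h⟩ := h
  exact ⟨F, hF, fun t => by rw [compl_compl]; exact (h t).symm⟩

theorem isDecided_of_forall_exists {X : Set (ℕ → S)} {F : List S → Set S} (hF : ∀ l, F l ∈ U)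
    (h : ∀ z ∈ X, ∀ N, z ∈ branches F (res z N) → ∃ n ≥ N, ∃ F' : List S → Set S,
      (∀ l, F' l ∈ U) ∧ branches F' (res z n) ⊆ X) : IsDecided U X := by
  classical
  let G : Set (List S) := {t | ∃ F' : List S → Set S, (∀ l, F' l ∈ U) ∧ branches F' t ⊆ X}
  have hG : ∀ t, ∃ F' : List S → Set S, (∀ l, F' l ∈ U) ∧ (t ∈ G → branches F' t ⊆ X) := by
    intro t
    by_cases ht : t ∈ G
    · obtain ⟨F', h1, h2⟩ := ht
      exact ⟨F', h1, fun _ => h2⟩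
    · exact ⟨fun _ => univ, fun _ => univ_mem, fun h => absurd h ht⟩
  choose Fam hFam hFamG using hG
  obtain ⟨D, hD, hDsub⟩ := exists_branches_subset hFam
  have hmerge : ∀ t, t ∉ G → {w | w :: t ∉ G} ∈ U := by
    intro t
    contrapose!
    intro hn
    have hmem : {w | w :: t ∈ G} ∈ U := by
      have := Ultrafilter.compl_mem_iff_notMem.2 hn
      simpa only [compl_ofPred, not_not] using this
    refine ⟨fun l => D l ∩ {w | l = t → w :: l ∈ G}, fun l => inter_mem (hD l) ?_, ?_⟩
    · by_cases hl : l = t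
      · simpa [hl] using hmem
      · simp [hl]
    · intro z hz
      have hzG : res z (t.length + 1) ∈ G := by
        rw [res_succ]
        exact (hz.2 t.length le_rfl).2 hz.1
      refine hFamG _ hzG (hDsub _ (mem_branches_res fun n hn => ?_))
      exact (hz.2 n (Nat.le_of_succ_le hn)).1
  refine ⟨fun l => F l ∩ D l ∩ {w | l ∉ G → w :: l ∉ G}, fun l => ?_, fun t => ?_⟩
  · refine inter_mem (inter_mem (hF l) (hD l)) ?_
    by_cases hl : l ∈ G
    · simp [hl]
    · simpa [hl] using hmerge l hl
  by_cases ht : t ∈ G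
  · refine Or.inl (((branches_mono (fun l => ?_) t).trans (hDsub t)).trans (hFamG t ht))
    exact inter_subset_left.trans inter_subset_right
  · refine Or.inr fun z hz hzX => ?_
    have hnot : ∀ n, t.length ≤ n → res z n ∉ G := by
      intro n hn
      induction n, hn using Nat.le_induction with
      | base => rwa [hz.1]
      | succ n hn ih => rw [res_succ]; exact (hz.2 n hn).2 ih
    obtain ⟨n, hn, F', hF', hsub⟩ := h z hzX t.length
      (mem_branches_res fun n hn => (hz.2 n hn).1.1)
    exact hnot n hn ⟨F', hF', hsub⟩

theorem IsDecided.iUnion {X : ℕ → Set (ℕ → S)} (hX : ∀ i, IsDecided U (X i)) :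
    IsDecided U (⋃ i, X i) := by
  choose F hF hdec using hX
  obtain ⟨F', hF', hsub⟩ := exists_forall_eventually hF
  refine isDecided_of_forall_exists hF' fun z hz N hzN => ?_
  obtain ⟨i, hi⟩ := mem_iUnion.1 hz
  have hmem : z ∈ branches (F i) (res z (max i N)) := mem_branches_res fun n hn =>
    hsub _ i (by simpa using (le_max_left _ _).trans hn)
      (hzN.2 n (by simpa using (le_max_right _ _).trans hn))
  refine ⟨max i N, le_max_right _ _, F i, hF i, ?_⟩
  rcases hdec i (res z (max i N)) with h | h
  · exact h.trans (subset_iUnion X i)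
  · exact absurd hi (h hmem)

theorem isDecided_of_res {X : Set (ℕ → S)} (n : ℕ)
    (hX : ∀ z z', res z n = res z' n → z ∈ X → z' ∈ X) : IsDecided U X := by
  refine isDecided_of_forall_exists (F := fun _ => univ) (fun _ => univ_mem) fun z hz N _ => ?_
  refine ⟨max n N, le_max_right _ _, fun _ => univ, fun _ => univ_mem, fun z' hz' => ?_⟩
  refine hX z z' ?_ hz
  have := hz'.1
  rw [res_length] at this
  exact res_eq_res.2 fun m hm => (res_eq_res.1 this (hm.trans_le (le_max_left _ _))).symm

/-- The `σ`-algebra of sets decided by `U`-trees. -/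
abbrev decidedSpace (U : Ultrafilter S) : MeasurableSpace (ℕ → S) where
  MeasurableSet' := IsDecided U
  measurableSet_empty := isDecided_of_res 0 (by simp)
  measurableSet_compl _ := IsDecided.compl
  measurableSet_iUnion _ := IsDecided.iUnion

/-- A countable cover by decided sets contains all branches through some stem of a `U`-tree. -/
theorem exists_branches_subset_of_iUnion {X : ℕ → Set (ℕ → S)} (hX : ∀ i, IsDecided U (X i))
    (hcov : ⋃ i, X i = univ) {F₀ : List S → Set S} (hF₀ : ∀ l, F₀ l ∈ U) :
    ∃ i, ∃ F : List S → Set S, ∃ z N, (∀ l, F l ∈ U) ∧ z ∈ branches F₀ [] ∧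
      branches F (res z N) ⊆ X i := by
  choose F hF hdec using hX
  obtain ⟨F', hF', hsub⟩ := exists_forall_eventually hF
  obtain ⟨z, hz⟩ := exists_mem_branches (fun l => F' l ∩ F₀ l)
    fun l => U.neBot.nonempty_of_mem (inter_mem (hF' l) (hF₀ l))
  obtain ⟨i, hi⟩ := mem_iUnion.1 (hcov ▸ mem_univ z)
  refine ⟨i, F i, z, i, hF i, branches_mono (fun l => inter_subset_right) _ hz, ?_⟩
  have hmem : z ∈ branches (F i) (res z i) := mem_branches_res fun n hn =>
    hsub _ i (by simpa using hn) (hz.2 n (by simp)).1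
  exact (hdec i _).resolve_right fun h => h hmem hi

end Ramsey

section Idempotent

/-- An idempotent ultrafilter on words concentrating on words with large first letter. -/
theorem exists_idempotent_ultrafilter_list :
    ∃ U : Ultrafilter (List ℕ), (∀ n, ∀ᶠ w : List ℕ in U, n < w.headI) ∧
      ∀ p : List ℕ → Prop, (∀ᶠ w in U, p w) → ∀ᶠ w in U, ∀ᶠ v in U, p (w ++ v) := by
  let _ : Mul (Ultrafilter (FreeMonoid ℕ)) := Ultrafilter.mul
  let _ : Semigroup (Ultrafilter (FreeMonoid ℕ)) := Ultrafilter.semigroup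
  let s : Set (Ultrafilter (FreeMonoid ℕ)) :=
    ⋂ n, {U | {w : FreeMonoid ℕ | n < w.toList.headI} ∈ U}
  have hs : ∀ U, U ∈ s ↔ ∀ n, ∀ᶠ w in (U : Filter (FreeMonoid ℕ)), n < w.toList.headI := by
    intro U
    simp only [s, mem_iInter]
    rfl
  have hne : s.Nonempty := by
    refine ⟨(hyperfilter ℕ).map FreeMonoid.of, (hs _).2 fun n => ?_⟩
    refine eventually_map.2 ?_
    have : ∀ᶠ k in (hyperfilter ℕ : Filter ℕ), n < k :=
      Nat.hyperfilter_le_atTop (eventually_gt_atTop n)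
    exact this.mono fun k hk => hk
  have hcomp : IsCompact s :=
    (isClosed_iInter fun n => ultrafilter_isClosed_basic _).isCompact
  obtain ⟨U, hU, hidem⟩ := exists_idempotent_in_compact_subsemigroup
    (M := Ultrafilter (FreeMonoid ℕ)) Ultrafilter.continuous_mul_left s hne hcomp (by
      intro U hU V hV
      refine (hs _).2 fun n => (Ultrafilter.eventually_mul U V _).2 ?_
      refine ((hs U).1 hU n).mono fun w hw => Eventually.of_forall fun v => ?_
      rw [FreeMonoid.toList_mul]
      cases h : w.toList with
      | nil => simp [h] at hw
      | cons a l => simpa [h] using hw)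
  refine ⟨U, (hs U).1 hU, fun p hp => ?_⟩
  rw [← hidem] at hp
  exact (Ultrafilter.eventually_mul U U _).1 hp

end Idempotent

section Blocks

/-- The words `w` in `A` such that `w ++ v ∈ A` for `U`-many `v`. -/
def starSet (U : Ultrafilter (List ℕ)) (A : Set (List ℕ)) : Set (List ℕ) :=
  {w | w ∈ A ∧ ∀ᶠ v in U, w ++ v ∈ A}

theorem starSet_mem {U : Ultrafilter (List ℕ)}
    (hU : ∀ p : List ℕ → Prop, (∀ᶠ w in U, p w) → ∀ᶠ w in U, ∀ᶠ v in U, p (w ++ v))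
    {A : Set (List ℕ)} (hA : A ∈ U) : ∀ᶠ w in U, w ∈ starSet U A :=
  Eventually.and hA (hU (· ∈ A) hA)

theorem eventually_append_mem_starSet {U : Ultrafilter (List ℕ)}
    (hU : ∀ p : List ℕ → Prop, (∀ᶠ w in U, p w) → ∀ᶠ w in U, ∀ᶠ v in U, p (w ++ v))
    {A : Set (List ℕ)} {w : List ℕ} (hw : w ∈ starSet U A) :
    ∀ᶠ v in U, w ++ v ∈ starSet U A := by
  filter_upwards [hw.2, hU (fun v => w ++ v ∈ A) hw.2] with v h1 h2
  exact ⟨h1, by simpa using h2⟩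

/-- Add the word `w` of colour `b` to a reversed list of blocks with alternating colours, merging
it with the last block if that has colour `b`. -/
def putBlock (b : Bool) (w : List ℕ) : List (List ℕ) → List (List ℕ)
  | [] => [w]
  | v :: l => if l.length.bodd = b then (v ++ w) :: l else w :: v :: l

/-- The concatenation of the blocks of colour `b`. -/
def catBlocks (b : Bool) : List (List ℕ) → List ℕ
  | [] => []
  | w :: l => if l.length.bodd = b then catBlocks b l ++ w else catBlocks b l

theorem catBlocks_putBlock_self (b : Bool) (w : List ℕ) {l : List (List ℕ)} (hl : l ≠ []) :
    catBlocks b (putBlock b w l) = catBlocks b l ++ w := by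
  obtain ⟨v, l, rfl⟩ := List.exists_cons_of_ne_nil hl
  by_cases h : l.length.bodd = b
  · simp [putBlock, catBlocks, h]
  · simp [putBlock, catBlocks, h]

theorem catBlocks_putBlock_of_ne {b b' : Bool} (hb : b ≠ b') (w : List ℕ) {l : List (List ℕ)}
    (hl : l ≠ []) : catBlocks b' (putBlock b w l) = catBlocks b' l := by
  obtain ⟨v, l, rfl⟩ := List.exists_cons_of_ne_nil hl
  by_cases h : l.length.bodd = b
  · simp [putBlock, catBlocks, h, hb]
  · have : l.length.bodd = b' := by cases b <;> cases b' <;> simp_all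
    simp [putBlock, catBlocks, this, hb.symm]

theorem catBlocks_prefix_of_suffix (b : Bool) {l l' : List (List ℕ)} (h : l' <:+ l) :
    catBlocks b l' <+: catBlocks b l := by
  obtain ⟨k, rfl⟩ := h
  induction k with
  | nil => exact List.prefix_rfl
  | cons w k ih =>
    rw [List.cons_append, catBlocks]
    split_ifs
    · exact ih.trans (List.prefix_append _ _)
    · exact ih

theorem le_length_catBlocks (b : Bool) (m : ℕ) : ∀ {l : List (List ℕ)}, (∀ w ∈ l, w ≠ []) →
    2 * m ≤ l.length → m ≤ (catBlocks b l).length := by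
  induction m with
  | zero => simp
  | succ m ih =>
    intro l hl hlen
    match l with
    | [] => simp at hlen
    | [_] => simp at hlen; omega
    | w :: v :: l =>
      have h := ih (l := l) (fun u hu => hl u (by simp [hu])) (by simp at hlen; omega)
      have hv := List.length_pos_iff.2 (hl v (by simp))
      have hw := List.length_pos_iff.2 (hl w (by simp))
      rcases eq_or_ne l.length.bodd b with hb | hb
      · have : (!l.length.bodd) ≠ b := by simp [hb]
        simp [catBlocks, hb]; omega
      · have : (!l.length.bodd) = b := by cases b <;> simp_all
        simp [catBlocks, hb, this]; omega

/-- A nonempty state all of whose blocks beyond the stem `t` respect `F`. -/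
def IsGoodState (U : Ultrafilter (List ℕ)) (F : List (List ℕ) → Set (List ℕ))
    (t l : List (List ℕ)) : Prop :=
  ∃ v l', l = v :: l' ∧ v ∈ starSet U (F l') ∧ t <:+ l' ∧
    ∀ v' l'', v' :: l'' <:+ l' → t.length ≤ l''.length → v' ∈ F l''

theorem IsGoodState.eventually_putBlock {U : Ultrafilter (List ℕ)}
    (hU : ∀ p : List ℕ → Prop, (∀ᶠ w in U, p w) → ∀ᶠ w in U, ∀ᶠ v in U, p (w ++ v))
    {F : List (List ℕ) → Set (List ℕ)} (hF : ∀ l, F l ∈ U) {t l : List (List ℕ)}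
    (hl : IsGoodState U F t l) (b : Bool) :
    ∀ᶠ w in U, IsGoodState U F t (putBlock b w l) := by
  obtain ⟨v, l', rfl, hv, ht, hgood⟩ := hl
  by_cases hb : l'.length.bodd = b
  · filter_upwards [eventually_append_mem_starSet hU hv] with w hw
    exact ⟨v ++ w, l', by simp [putBlock, hb], hw, ht, hgood⟩
  · filter_upwards [starSet_mem hU (hF (v :: l'))] with w hw
    refine ⟨w, v :: l', by simp [putBlock, hb], hw, ht.trans (List.suffix_cons _ _), ?_⟩
    intro v' l'' h hlen
    rcases List.suffix_cons_iff.1 h with h | h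
    · obtain ⟨rfl, rfl⟩ := List.cons.inj h
      exact hv.1
    · exact hgood v' l'' h hlen

/-- The states reached by successively adding words `a i` with prescribed colours. -/
def blockState (l₀ : List (List ℕ)) (a : ℕ → List ℕ) (χ : ℕ → Option Bool) :
    ℕ → List (List ℕ)
  | 0 => l₀
  | i + 1 => (χ i).elim (blockState l₀ a χ i) fun b => putBlock b (a i) (blockState l₀ a χ i)

theorem exists_isGoodState_blockState {U : Ultrafilter (List ℕ)}
    (hhead : ∀ n, ∀ᶠ w : List ℕ in U, n < w.headI)
    (hU : ∀ p : List ℕ → Prop, (∀ᶠ w in U, p w) → ∀ᶠ w in U, ∀ᶠ v in U, p (w ++ v))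
    {F : List (List ℕ) → Set (List ℕ)} (hF : ∀ l, F l ∈ U) (t : List (List ℕ)) :
    ∃ (l₀ : List (List ℕ)) (a : ℕ → List ℕ), StrictMono (fun i => (a i).headI) ∧
      (∀ i, a i ≠ []) ∧ ∀ χ i, IsGoodState U F t (blockState l₀ a χ i) := by
  obtain ⟨w₀, hw₀⟩ := (starSet_mem hU (hF t)).exists
  have hgood₀ : IsGoodState U F t (w₀ :: t) := by
    refine ⟨w₀, t, rfl, hw₀, List.suffix_rfl, fun v l h hlen => ?_⟩
    have := h.length_le
    simp at this
    omega
  let Q := {p : Set (List (List ℕ)) × ℕ // p.1.Finite ∧ ∀ l ∈ p.1, IsGoodState U F t l}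
  have hstep : ∀ q : Q, ∃ w : List ℕ, q.1.2 < w.headI ∧
      ∀ l ∈ q.1.1, ∀ b, IsGoodState U F t (putBlock b w l) := by
    rintro ⟨⟨R, n⟩, hfin, hR⟩
    have : ∀ᶠ w in (U : Filter (List ℕ)), ∀ l ∈ R, ∀ b, IsGoodState U F t (putBlock b w l) :=
      (eventually_all_finite hfin).2 fun l hl => eventually_all.2 fun b =>
        (hR l hl).eventually_putBlock hU hF b
    exact ((hhead n).and this).exists
  choose w hwhead hw using hstep
  let next : Q → Q := fun q =>
    ⟨(q.1.1 ∪ ⋃ b : Bool, putBlock b (w q) '' q.1.1, (w q).headI),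
      q.2.1.union (finite_iUnion fun b => q.2.1.image _), by
        rintro l (hl | hl)
        · exact q.2.2 l hl
        · obtain ⟨b, l', hl', rfl⟩ := mem_iUnion.1 hl
          exact hw q l' hl' b⟩
  let q : ℕ → Q := fun i => i.rec ⟨({w₀ :: t}, 0), finite_singleton _, by simpa using hgood₀⟩
    fun _ q => next q
  have hq : ∀ i, q (i + 1) = next (q i) := fun _ => rfl
  refine ⟨w₀ :: t, fun i => w (q i), strictMono_nat_of_lt_succ fun i => ?_, fun i hi => ?_,
    fun χ i => (q i).2.2 _ ?_⟩
  · exact hwhead (q (i + 1))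
  · have := hwhead (q i)
    simp [hi] at this
  · induction i with
    | zero => exact rfl
    | succ i ih =>
      rw [blockState, hq]
      cases χ i with
      | none => exact Or.inl ih
      | some b => exact Or.inr (mem_iUnion.2 ⟨b, _, ih, rfl⟩)

end Blocks

section Merge

theorem res_eq_of_forall_getElem {S : Type*} {z : ℕ → S} : ∀ {l : List S},
    (∀ n (h : n < l.reverse.length), l.reverse[n] = z n) → res z l.length = l
  | [], _ => rfl
  | w :: l, h => by
    have h1 := h l.length (by simp)
    rw [List.length_cons, res_succ, res_eq_of_forall_getElem (l := l) fun n hn => ?_]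
    · simpa using h1.symm
    · rw [← h n (by simp at hn ⊢; omega)]
      simp only [List.reverse_cons]
      rw [List.getElem_append_left]

theorem res_eq_of_suffix {S : Type*} {z : ℕ → S} {l : List S} {n : ℕ} (h : l <:+ res z n) :
    res z l.length = l := by
  have hle : l.length ≤ n := by simpa using h.length_le
  exact (List.suffix_of_suffix_length_le (res_suffix_res z hle) h (by simp)).eq_of_length
    (by simp)

theorem exists_res_eq {S : Type*} {T : ℕ → List S} (hT : ∀ i j, i ≤ j → T i <:+ T j)
    (hlen : ∀ n, ∃ i, n ≤ (T i).length) : ∃ z, ∀ i, res z (T i).length = T i := by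
  choose i hi using fun n => hlen (n + 1)
  refine ⟨fun n => (T (i n)).reverse[n]'(by simpa using hi n), fun j => ?_⟩
  refine res_eq_of_forall_getElem fun n hn => ?_
  rcases le_total j (i n) with h | h
  · exact (List.reverse_prefix.2 (hT _ _ h)).getElem hn
  · exact ((List.reverse_prefix.2 (hT _ _ h)).getElem (by simpa using hi n)).symm

theorem tail_putBlock (b : Bool) (w : List ℕ) {l : List (List ℕ)} (hl : l ≠ []) :
    l.tail <:+ (putBlock b w l).tail ∧
      (l.tail.length.bodd ≠ b → (putBlock b w l).tail.length = l.tail.length + 1) := by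
  obtain ⟨v, l, rfl⟩ := List.exists_cons_of_ne_nil hl
  by_cases h : l.length.bodd = b
  · simp [putBlock, h]
  · simp [putBlock, h]

variable {U : Ultrafilter (List ℕ)} {F : List (List ℕ) → Set (List ℕ)} {t l₀ : List (List ℕ)}
  {a : ℕ → List ℕ} {χ : ℕ → Option Bool}

theorem IsGoodState.ne_nil {l : List (List ℕ)} (h : IsGoodState U F t l) : l ≠ [] := by
  obtain ⟨v, l', rfl, -⟩ := h
  simp

theorem exists_branch_blockState (hgood : ∀ i, IsGoodState U F t (blockState l₀ a χ i))
    (hχ : ∀ b i, ∃ j ≥ i, χ j = some b) : ∃ z ∈ branches F t,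
      ∀ n, ∃ N, ∀ i ≥ N, res z n <:+ blockState l₀ a χ i := by
  have hsucc : ∀ i, (blockState l₀ a χ i).tail <:+ (blockState l₀ a χ (i + 1)).tail := by
    intro i
    rw [blockState]
    cases χ i with
    | none => exact List.suffix_rfl
    | some b => exact (tail_putBlock b _ (hgood i).ne_nil).1
  have hmono : ∀ i j, i ≤ j → (blockState l₀ a χ i).tail <:+ (blockState l₀ a χ j).tail := by
    intro i j hij
    induction j, hij using Nat.le_induction with
    | base => exact List.suffix_rfl
    | succ j _ ih => exact ih.trans (hsucc j)
  have hlen : ∀ n, ∃ i, n ≤ (blockState l₀ a χ i).tail.length := by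
    intro n
    induction n with
    | zero => exact ⟨0, Nat.zero_le _⟩
    | succ n ih =>
      obtain ⟨i, hi⟩ := ih
      obtain ⟨j, hij, hj⟩ := hχ (!(blockState l₀ a χ i).tail.length.bodd) i
      have hle := (hmono i j hij).length_le
      rcases hle.lt_or_eq with h | h
      · exact ⟨j, by omega⟩
      · refine ⟨j + 1, ?_⟩
        have h2 := (tail_putBlock (!(blockState l₀ a χ i).tail.length.bodd) (a j)
          (hgood j).ne_nil).2 (by rw [← h]; simp)
        rw [blockState, hj, Option.elim_some, h2]
        omega
  obtain ⟨z, hz⟩ := exists_res_eq hmono hlen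
  have hsuf : ∀ n, ∃ N, res z n <:+ (blockState l₀ a χ N).tail := by
    intro n
    obtain ⟨N, hN⟩ := hlen n
    exact ⟨N, by rw [← hz N]; exact res_suffix_res z hN⟩
  refine ⟨z, ⟨?_, fun n hn => ?_⟩, fun n => ?_⟩
  · obtain ⟨v, l', h, -, ht, -⟩ := hgood 0
    refine res_eq_of_suffix (n := (blockState l₀ a χ 0).tail.length) ?_
    rw [hz, h]
    exact ht
  · obtain ⟨N, hN⟩ := hsuf (n + 1)
    obtain ⟨v, l', h, -, -, hF⟩ := hgood N
    rw [h, List.tail_cons, res_succ] at hN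
    exact hF _ _ hN (by simpa using hn)
  · obtain ⟨N, hN⟩ := hsuf n
    exact ⟨N, fun i hi => (hN.trans (hmono N i hi)).trans (List.tail_suffix _)⟩

theorem catBlocks_blockState (hgood : ∀ i, IsGoodState U F t (blockState l₀ a χ i)) (b : Bool)
    (i : ℕ) : catBlocks b (blockState l₀ a χ (i + 1)) =
      if χ i = some b then catBlocks b (blockState l₀ a χ i) ++ a i
      else catBlocks b (blockState l₀ a χ i) := by
  rw [blockState]
  cases χ i with
  | none => simp
  | some b' =>
    rcases eq_or_ne b' b with rfl | hb
    · simpa using catBlocks_putBlock_self _ _ (hgood i).ne_nil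
    · simpa [hb] using catBlocks_putBlock_of_ne hb _ (hgood i).ne_nil

/-- A code for finite sequences, strictly increasing along branches and in the last entry. -/
def pathIndex : List ℕ → ℕ
  | [] => 0
  | k :: l => pathIndex l + k + 1

/-- The word read along the path `l` in the tree of colour `b`. -/
def pathWord (b : Bool) (p : List ℕ) (a : ℕ → List ℕ) : List ℕ → List ℕ
  | [] => p
  | k :: l => pathWord b p a l ++ a (Nat.bit b (pathIndex (k :: l)))

theorem strictMono_bit (b : Bool) : StrictMono (Nat.bit b) := fun m n h => by
  cases b <;> simp [Nat.bit] <;> omega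

theorem strictMono_pathIndex (g : ℕ → ℕ) :
    StrictMono fun n => pathIndex (res g (n + 1)) :=
  strictMono_nat_of_lt_succ fun n => by
    rw [res_succ g (n + 1), pathIndex]
    omega

theorem catBlocks_blockState_eq_pathWord
    (hgood : ∀ i, IsGoodState U F t (blockState l₀ a χ i)) {b : Bool} {g : ℕ → ℕ}
    (hχ : ∀ i, χ i = some b ↔ ∃ n, Nat.bit b (pathIndex (res g (n + 1))) = i) (n : ℕ) :
    catBlocks b (blockState l₀ a χ (Nat.bit b (pathIndex (res g (n + 1))))) =
      pathWord b (catBlocks b l₀) a (res g n) := by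
  have hconst : ∀ i j, i ≤ j → (∀ k, i ≤ k → k < j → χ k ≠ some b) →
      catBlocks b (blockState l₀ a χ j) = catBlocks b (blockState l₀ a χ i) := by
    intro i j hij
    induction j, hij using Nat.le_induction with
    | base => simp
    | succ j hj ih =>
      intro h
      rw [catBlocks_blockState hgood, if_neg (h j hj j.lt_succ_self),
        ih fun k h1 h2 => h k h1 (h2.trans j.lt_succ_self)]
  have hmono : StrictMono fun n => Nat.bit b (pathIndex (res g (n + 1))) :=
    (strictMono_bit b).comp (strictMono_pathIndex g)
  induction n with
  | zero =>
    rw [hconst 0 _ (Nat.zero_le _), res_zero, pathWord, blockState]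
    intro k _ hk h
    obtain ⟨m, rfl⟩ := (hχ k).1 h
    exact absurd (hmono.lt_iff_lt.1 hk) (by simp)
  | succ n ih =>
    rw [hconst _ _ (Nat.succ_le_of_lt (hmono n.lt_succ_self)), catBlocks_blockState hgood,
      if_pos ((hχ _).2 ⟨n, rfl⟩), ih]
    · conv_rhs => rw [res_succ, pathWord, ← res_succ]
    · intro k h1 h2 h
      obtain ⟨m, rfl⟩ := (hχ k).1 h
      have := hmono.lt_iff_lt.1 h2
      have := hmono.lt_iff_lt.1 (Nat.lt_of_succ_le h1)
      omega

theorem getD_eq_of_prefix_of_lt {l l' : List ℕ} (h : l <+: l') {m : ℕ} (hm : m < l.length) :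
    l.getD m 0 = l'.getD m 0 := by
  obtain ⟨k, rfl⟩ := h
  rw [List.getD_append _ _ _ _ hm]

/-- The infinite word formed by the blocks of colour `b`. -/
def blockReal (b : Bool) (z : ℕ → List ℕ) (m : ℕ) : ℕ :=
  (catBlocks b (res z (2 * (m + 1)))).getD m 0

/-- The infinite word read along the branch `g` of the tree of colour `b`. -/
def pathReal (b : Bool) (p : List ℕ) (a : ℕ → List ℕ) (g : ℕ → ℕ) (m : ℕ) : ℕ :=
  (pathWord b p a (res g (m + 1))).getD m 0

theorem pathWord_prefix_of_le (b : Bool) (p : List ℕ) (a : ℕ → List ℕ) (g : ℕ → ℕ) {m n : ℕ}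
    (h : m ≤ n) : pathWord b p a (res g m) <+: pathWord b p a (res g n) := by
  induction n, h using Nat.le_induction with
  | base => exact List.prefix_rfl
  | succ n _ ih => exact ih.trans (by rw [res_succ, pathWord]; exact List.prefix_append _ _)

theorem le_length_pathWord (ha : ∀ i, a i ≠ []) (b : Bool) (p : List ℕ) (g : ℕ → ℕ) (n : ℕ) :
    n ≤ (pathWord b p a (res g n)).length := by
  induction n with
  | zero => simp
  | succ n ih =>
    have := List.length_pos_iff.2 (ha (Nat.bit b (pathIndex (g n :: res g n))))
    rw [res_succ, pathWord, List.length_append]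
    omega

theorem isSplitting_pathReal (ha : ∀ i, a i ≠ []) (hmono : StrictMono fun i => (a i).headI)
    (b : Bool) (p : List ℕ) : IsSplitting (pathReal b p a) := by
  refine ⟨continuous_pi fun m => continuous_of_res (m + 1) fun g g' h => ?_,
    fun l => (pathWord b p a l).length,
    fun l k => (a (Nat.bit b (pathIndex (k :: l)))).headI, fun l => ?_, fun g n => ?_⟩
  · simp only [pathReal, h]
  · refine hmono.comp ((strictMono_bit b).comp fun k k' h => ?_)
    simp only [pathIndex]
    omega
  · have hlen : (pathWord b p a (res g n)).length < (pathWord b p a (res g (n + 1))).length := by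
      rw [res_succ, pathWord, List.length_append]
      exact Nat.lt_add_of_pos_right (List.length_pos_iff.2 (ha _))
    rw [pathReal, ← getD_eq_of_prefix_of_lt (pathWord_prefix_of_le b p a g
      (Nat.succ_le_succ (le_length_pathWord ha b p g n))) hlen, res_succ, pathWord]
    obtain ⟨c, w, hw⟩ := List.exists_cons_of_ne_nil (ha (Nat.bit b (pathIndex (g n :: res g n))))
    simp [hw]

/-- Any two branches of the trees of the two colours are merged by a branch of the `U`-tree. -/
theorem exists_branch_blockReal_eq (ha : ∀ i, a i ≠ [])
    (hgood : ∀ χ i, IsGoodState U F t (blockState l₀ a χ i))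
    (hne : ∀ z ∈ branches F t, ∀ n, z n ≠ []) (G : Bool → ℕ → ℕ) :
    ∃ z ∈ branches F t, ∀ b, blockReal b z = pathReal b (catBlocks b l₀) a (G b) := by
  classical
  let χ : ℕ → Option Bool := fun i =>
    if ∃ n, Nat.bit i.bodd (pathIndex (res (G i.bodd) (n + 1))) = i then some i.bodd else none
  have hχ : ∀ b i, χ i = some b ↔ ∃ n, Nat.bit b (pathIndex (res (G b) (n + 1))) = i := by
    intro b i
    constructor
    · intro h
      by_cases hex : ∃ n, Nat.bit i.bodd (pathIndex (res (G i.bodd) (n + 1))) = i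
      · simp only [χ, if_pos hex, Option.some.injEq] at h
        rwa [h] at hex
      · simp only [χ, if_neg hex, reduceCtorEq] at h
    · rintro ⟨n, hn⟩
      have hb : i.bodd = b := by rw [← hn, Nat.bodd_bit]
      have hex : ∃ n, Nat.bit i.bodd (pathIndex (res (G i.bodd) (n + 1))) = i :=
        ⟨n, by rw [hb]; exact hn⟩
      simp only [χ]
      rw [if_pos hex, hb]
  have hmono : ∀ b, StrictMono fun n => Nat.bit b (pathIndex (res (G b) (n + 1))) :=
    fun b => (strictMono_bit b).comp (strictMono_pathIndex (G b))
  obtain ⟨z, hz, hsuf⟩ := exists_branch_blockState (hgood χ) fun b i =>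
    ⟨_, (hmono b).le_apply, (hχ b _).2 ⟨i, rfl⟩⟩
  have hres : ∀ n, ∀ w ∈ res z n, w ≠ [] := by
    intro n
    induction n with
    | zero => simp
    | succ n ih =>
      rw [res_succ]
      exact List.forall_mem_cons.2 ⟨hne z hz n, ih⟩
  refine ⟨z, hz, fun b => funext fun m => ?_⟩
  obtain ⟨N, hN⟩ := hsuf (2 * (m + 1))
  have hpre := catBlocks_prefix_of_suffix b (hN _ ((le_max_left N (m + 1)).trans
    ((hmono b).le_apply (x := max N (m + 1)))))
  rw [catBlocks_blockState_eq_pathWord (hgood χ) (hχ b)] at hpre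
  rw [blockReal, pathReal,
    getD_eq_of_prefix_of_lt hpre (le_length_catBlocks b (m + 1) (hres _) (by simp)),
    getD_eq_of_prefix_of_lt (pathWord_prefix_of_le b _ a (G b) (le_max_right N (m + 1)))
      (le_length_pathWord ha b _ _ _)]

end Merge

/-- A countable Borel cover of the plane has a member containing a superperfect rectangle. -/
theorem exists_isSplitting_rectangle {A : ℕ → Set ((ℕ → ℕ) × (ℕ → ℕ))}
    (hA : ∀ n, MeasurableSet (A n)) (hcov : ⋃ n, A n = univ) :
    ∃ n φ ψ, IsSplitting φ ∧ IsSplitting ψ ∧ ∀ g h, (φ g, ψ h) ∈ A n := by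
  obtain ⟨U, hhead, hU⟩ := exists_idempotent_ultrafilter_list
  have hmeas : @Measurable _ _ (decidedSpace U) _
      fun z : ℕ → List ℕ => (blockReal false z, blockReal true z) := by
    let := decidedSpace U
    have : ∀ b, Measurable (blockReal b) := fun b => measurable_pi_lambda _ fun m s _ =>
      isDecided_of_res (2 * (m + 1)) fun z z' h hz => by
        simpa only [mem_preimage, blockReal, h] using hz
    exact (this false).prodMk (this true)
  have hne : {w : List ℕ | w ≠ []} ∈ U := (hhead 0).mono fun w hw h => by simp [h] at hw
  obtain ⟨n, F, z₀, N, hF, hz₀, hsub⟩ := exists_branches_subset_of_iUnion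
    (fun n => hmeas (hA n)) (by rw [← preimage_iUnion, hcov, preimage_univ])
    (F₀ := fun _ => {w | w ≠ []}) fun _ => hne
  obtain ⟨l₀, a, hmono, ha, hgood⟩ := exists_isGoodState_blockState hhead hU
    (fun l => inter_mem (hF l) hne) (res z₀ N)
  refine ⟨n, _, _, isSplitting_pathReal ha hmono false (catBlocks false l₀),
    isSplitting_pathReal ha hmono true (catBlocks true l₀), fun g h => ?_⟩
  obtain ⟨z, hz, hreal⟩ := exists_branch_blockReal_eq ha hgood (fun z hz k => by
    rcases lt_or_ge k N with hk | hk
    · have := hz.1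
      rw [res_length] at this
      rw [res_eq_res.1 this hk]
      exact hz₀.2 k (Nat.zero_le _)
    · exact (hz.2 k (by simpa using hk)).2) (fun b => cond b h g)
  have := hsub (branches_mono (fun l => inter_subset_left) _ hz)
  simpa [hreal] using this

/-- Spinas: `MRR(I, I)` holds for the Miller ideal `I`.  If a rectangle with
Miller-positive Borel sides is covered by countably many Borel sets, then one
of them contains a rectangle with Miller-positive Borel sides. -/
theorem mrr_miller_two_dimensional
    (B C : Set (ℕ → ℕ)) (hB : MeasurableSet B) (hC : MeasurableSet C)
    (hBpos : MillerPositive B) (hCpos : MillerPositive C)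
    (A : ℕ → Set ((ℕ → ℕ) × (ℕ → ℕ))) (hA : ∀ n, MeasurableSet (A n))
    (hcov : B ×ˢ C ⊆ ⋃ n, A n) :
    ∃ (n : ℕ) (B' C' : Set (ℕ → ℕ)),
      MeasurableSet B' ∧ B' ⊆ B ∧ MillerPositive B' ∧
      MeasurableSet C' ∧ C' ⊆ C ∧ MillerPositive C' ∧
      B' ×ˢ C' ⊆ A n := by
  obtain ⟨f, hf, hfB⟩ := hBpos.exists_isSplitting hB.analyticSet
  obtain ⟨f', hf', hfC⟩ := hCpos.exists_isSplitting hC.analyticSet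
  have hrange : ∀ {f φ : (ℕ → ℕ) → ℕ → ℕ}, IsSplitting f → IsSplitting φ →
      MeasurableSet (range (f ∘ φ)) ∧ MillerPositive (range (f ∘ φ)) := fun hf hφ =>
    ⟨((hf.continuous.comp hφ.continuous).measurableEmbedding
      (hf.injective.comp hφ.injective)).measurableSet_range,
      millerPositive_range fun _ hK => hφ.isCompact_preimage (hf.isCompact_preimage hK)⟩
  obtain ⟨n, φ, ψ, hφ, hψ, hsub⟩ := exists_isSplitting_rectangle
    (A := fun n => Prod.map f f' ⁻¹' A n)
    (fun n => (hf.continuous.measurable.prodMap hf'.continuous.measurable) (hA n)) (by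
      rw [← preimage_iUnion]
      exact eq_univ_of_forall fun x =>
        hcov ⟨hfB (mem_range_self x.1), hfC (mem_range_self x.2)⟩)
  refine ⟨n, range (f ∘ φ), range (f' ∘ ψ), (hrange hf hφ).1,
    (range_comp_subset_range _ _).trans hfB, (hrange hf hφ).2, (hrange hf' hψ).1,
    (range_comp_subset_range _ _).trans hfC, (hrange hf' hψ).2, ?_⟩
  rintro ⟨_, _⟩ ⟨⟨g, rfl⟩, h, rfl⟩
  exact hsub g h
end

section
/- Let G be the graph on 2^ω connecting two sequences iff they differ in exactly one coordinate. Let (Bᵢ)ᵢ∈ℕ be Silver-positive Borel subsets of 2^ω and let (Cₙ)ₙ∈ℕ be Borel subsets of (2^ω)^ℕ such that {x : ℕ → 2^ω | ∀ i, x i ∈ Bᵢ} ⊆ ⋃ₙ Cₙ. Then there exist an index n and Silver-positive Borel sets Bᵢ' ⊆ Bᵢ (for every i ∈ ℕ) such that {x : ℕ → 2^ω | ∀ i, x i ∈ Bᵢ'} ⊆ Cₙ. (MRR(I, I, I, ...) for the Silver ideal I.) -/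
/-- The Silver graph on Cantor space: two sequences are connected iff they
differ in exactly one coordinate. -/
def SilverAdj (x y : ℕ → Bool) : Prop := ∃! n : ℕ, x n ≠ y n

/-- A set `B ⊆ 2^ω` is Silver-small if it is covered by countably many Borel
sets independent with respect to the Silver graph; otherwise it is
Silver-positive. -/
def SilverPositive (B : Set (ℕ → Bool)) : Prop :=
  ¬ ∃ D : ℕ → Set (ℕ → Bool),
      (∀ n, MeasurableSet (D n)) ∧
      (∀ n, ∀ x ∈ D n, ∀ y ∈ D n, ¬ SilverAdj x y) ∧
      B ⊆ ⋃ n, D n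

open Set Filter Topology

/-- Flip the coordinates of `x` belonging to `T`. -/
noncomputable def flipOn {J : Type*} (T : Set J) (x : J → Bool) : J → Bool :=
  open Classical in fun j => xor (x j) (decide (j ∈ T))

section FlipOn

variable {J : Type*}

lemma flipOn_apply_of_mem {T : Set J} {x : J → Bool} {j : J} (h : j ∈ T) :
    flipOn T x j = !x j := by
  simp [flipOn, h]

lemma flipOn_apply_of_notMem {T : Set J} {x : J → Bool} {j : J} (h : j ∉ T) :
    flipOn T x j = x j := by
  simp [flipOn, h]

@[simp] lemma flipOn_empty (x : J → Bool) : flipOn ∅ x = x := by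
  ext j
  simp [flipOn]

lemma flipOn_apply_congr {S T : Set J} {x y : J → Bool} {j : J} (hT : j ∈ S ↔ j ∈ T)
    (hx : x j = y j) : flipOn S x j = flipOn T y j := by
  simp [flipOn, hT, hx]

lemma flipOn_flipOn_of_disjoint {S T : Set J} (h : Disjoint S T) (x : J → Bool) :
    flipOn S (flipOn T x) = flipOn (S ∪ T) x := by
  ext j
  by_cases hS : j ∈ S
  · have hT : j ∉ T := Set.disjoint_left.1 h hS
    simp [flipOn, hS, hT]
  · simp [flipOn, hS]

lemma flipOn_involutive (T : Set J) : Function.Involutive (flipOn T) := by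
  intro x
  ext j
  simp [flipOn]

lemma continuous_flipOn (T : Set J) : Continuous (flipOn T) := by
  refine continuous_pi fun j => ?_
  exact (continuous_of_discreteTopology (f := fun b : Bool => xor b _)).comp
    (continuous_apply j)

lemma isOpenMap_flipOn (T : Set J) : IsOpenMap (flipOn T) := by
  intro U hU
  rw [Set.image_eq_preimage_of_inverse (flipOn_involutive T).leftInverse
    (flipOn_involutive T).rightInverse]
  exact hU.preimage (continuous_flipOn T)

end FlipOn

lemma SilverAdj.exists_flipOn {x y : ℕ → Bool} (h : SilverAdj x y) :
    ∃ n, flipOn {n} x = y := by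
  obtain ⟨n, hn, hu⟩ := h
  refine ⟨n, funext fun m => ?_⟩
  by_cases hm : m = n
  · subst hm
    rw [flipOn_apply_of_mem (mem_singleton m)]
    revert hn
    cases x m <;> cases y m <;> simp
  · rw [flipOn_apply_of_notMem (by simpa using hm)]
    by_contra hne
    exact hm (hu m hne)

lemma silverAdj_flipOn_singleton (n : ℕ) (x : ℕ → Bool) : SilverAdj x (flipOn {n} x) := by
  refine ⟨n, by simp [flipOn], fun m hm => ?_⟩
  by_contra hne
  exact hm (flipOn_apply_of_notMem (by simpa using hne)).symm

/-- A continuous homomorphism of the Silver graph to itself. -/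
def IsCubeMap (φ : (ℕ → Bool) → (ℕ → Bool)) : Prop :=
  Continuous φ ∧ ∀ x y, SilverAdj x y → SilverAdj (φ x) (φ y)

lemma IsCubeMap.comp {φ ψ : (ℕ → Bool) → (ℕ → Bool)} (hφ : IsCubeMap φ) (hψ : IsCubeMap ψ) :
    IsCubeMap (φ ∘ ψ) :=
  ⟨hφ.1.comp hψ.1, fun x y h => hφ.2 _ _ (hψ.2 x y h)⟩

lemma IsCubeMap.measurableSet_range {φ : (ℕ → Bool) → (ℕ → Bool)} (hφ : IsCubeMap φ) :
    MeasurableSet (range φ) :=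
  (isCompact_range hφ.1).isClosed.measurableSet

/-- Every infinite set of coordinates spans a Silver cube through every point. -/
lemma exists_isCubeMap_flipOn (x : ℕ → Bool) {H : Set ℕ} (hH : H.Infinite) :
    ∃ φ, IsCubeMap φ ∧ ∀ z, ∃ T ⊆ H, φ z = flipOn T x := by
  obtain ⟨a, ha, haH⟩ : ∃ a : ℕ → ℕ, Function.Injective a ∧ ∀ n, a n ∈ H :=
    ⟨fun n => hH.natEmbedding H n, fun m n h => (hH.natEmbedding H).injective (Subtype.ext h),
      fun n => (hH.natEmbedding H n).2⟩
  have key (z : ℕ → Bool) (n : ℕ) :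
      flipOn (a '' {n | z n = true}) x (a n) = xor (x (a n)) (z n) := by
    cases h : z n <;> simp [flipOn, ha.eq_iff, h]
  have key' (z : ℕ → Bool) (m : ℕ) (hm : m ∉ range a) :
      flipOn (a '' {n | z n = true}) x m = x m :=
    flipOn_apply_of_notMem fun h => hm (image_subset_range _ _ h)
  refine ⟨fun z => flipOn (a '' {n | z n = true}) x, ⟨?_, ?_⟩, fun z => ⟨_, ?_, rfl⟩⟩
  · refine continuous_pi fun m => ?_
    by_cases hm : m ∈ range a
    · obtain ⟨n, rfl⟩ := hm
      simp only [key]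
      exact (continuous_of_discreteTopology (f := fun b : Bool => xor _ b)).comp
        (continuous_apply n)
    · simp only [key' _ m hm]
      exact continuous_const
  · rintro y z ⟨n, hn, hu⟩
    refine ⟨a n, by simpa only [key, ne_eq, Bool.xor_right_inj] using hn, fun m hm => ?_⟩
    by_cases hma : m ∈ range a
    · obtain ⟨k, rfl⟩ := hma
      rw [hu k (by simpa only [key, ne_eq, Bool.xor_right_inj] using hm)]
    · simp only [key' _ m hma, ne_eq, not_true_eq_false] at hm
  · rintro _ ⟨n, -, rfl⟩
    exact haH n

/-! ### Comeager sets contain products of Silver cubes -/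

lemma exists_finset_subset_of_isOpen {J : Type*} {U : Set (J → Bool)} (hU : IsOpen U)
    {x : J → Bool} (hx : x ∈ U) :
    ∃ S : Finset J, ∀ y, (∀ j ∈ S, y j = x j) → y ∈ U := by
  obtain ⟨S, u, hu, hsub⟩ := isOpen_pi_iff.1 hU x hx
  exact ⟨S, fun y hy => hsub fun j hj => by rw [hy j hj]; exact (hu j hj).2⟩

/-- Given a residual set and a nonempty open set in `2^(ℕ × ℕ)`, there are a point and a set of
coordinates, infinite in every column, such that all flips of the point on this set of coordinates
belong to both. -/
lemma exists_flipOn_mem_residual {R O : Set (ℕ × ℕ → Bool)} (hR : R ∈ residual (ℕ × ℕ → Bool))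
    (hO : IsOpen O) (hne : O.Nonempty) :
    ∃ (x : ℕ × ℕ → Bool) (H : Set (ℕ × ℕ)), (∀ i, {m | (i, m) ∈ H}.Infinite) ∧
      ∀ T ⊆ H, flipOn T x ∈ R ∩ O := by
  classical
  obtain ⟨D, hDo, hDd, hDR⟩ : ∃ D : ℕ → Set (ℕ × ℕ → Bool),
      (∀ n, IsOpen (D n)) ∧ (∀ n, Dense (D n)) ∧ ⋂ n, D n ⊆ R := by
    obtain ⟨S, hSo, hSd, hSc, hSR⟩ := mem_residual_iff.1 hR
    rcases S.eq_empty_or_nonempty with rfl | hSne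
    · exact ⟨fun _ => univ, fun _ => isOpen_univ, fun _ => dense_univ, by simpa using hSR⟩
    · obtain ⟨D, rfl⟩ := hSc.exists_eq_range hSne
      exact ⟨D, fun n => hSo _ (mem_range_self n), fun n => hSd _ (mem_range_self n),
        by simpa using hSR⟩
  obtain ⟨x, hxO, hx⟩ : ∃ x ∈ O, ∀ (F : Finset (ℕ × ℕ)) (n : ℕ),
      flipOn (F : Set (ℕ × ℕ)) x ∈ D n := by
    have hres : {x | ∀ (F : Finset (ℕ × ℕ)) (n : ℕ), flipOn (F : Set (ℕ × ℕ)) x ∈ D n} ∈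
        residual (ℕ × ℕ → Bool) := by
      simp only [ofPred_forall]
      refine countable_iInter_mem.2 fun F => countable_iInter_mem.2 fun n => ?_
      exact tendsto_residual_of_isOpenMap (continuous_flipOn _) (isOpenMap_flipOn _)
        (residual_of_dense_open (hDo n) (hDd n))
    exact (dense_of_mem_residual hres).inter_open_nonempty O hO hne
  obtain ⟨S₀, hS₀⟩ := exists_finset_subset_of_isOpen hO hxO
  choose S hS using fun (F : Finset (ℕ × ℕ)) (n : ℕ) =>
    exists_finset_subset_of_isOpen (hDo n) (hx F n)
  -- `E F` supports all the requirements handled when the free coordinates are those in `F`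
  let E (F : Finset (ℕ × ℕ)) : Finset (ℕ × ℕ) :=
    S₀ ∪ F ∪ F.powerset.biUnion fun F' => (Finset.range (F.card + 1)).biUnion fun n => S F' n
  have hE_S {F F' : Finset (ℕ × ℕ)} {n : ℕ} (hF : F' ⊆ F) (hn : n ≤ F.card) : S F' n ⊆ E F := by
    intro j hj
    simp only [E, Finset.mem_union, Finset.mem_biUnion, Finset.mem_powerset, Finset.mem_range]
    exact Or.inr ⟨F', hF, n, by omega, hj⟩
  have hE_self (F : Finset (ℕ × ℕ)) : F ⊆ E F := fun j hj => by simp [E, hj]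
  have hE_base (F : Finset (ℕ × ℕ)) : S₀ ⊆ E F := fun j hj => by simp [E, hj]
  have hE_mono {F F' : Finset (ℕ × ℕ)} (h : F ⊆ F') : E F ⊆ E F' := by
    refine Finset.union_subset_union (Finset.union_subset_union le_rfl h) ?_
    refine Finset.biUnion_subset_biUnion_of_subset_left _ (Finset.powerset_mono.2 h) |>.trans ?_
    refine Finset.biUnion_mono fun F'' _ => Finset.biUnion_subset_biUnion_of_subset_left _ ?_
    exact Finset.range_subset_range.2 (Nat.succ_le_succ (Finset.card_le_card h))
  choose μ hμ using fun (F : Finset (ℕ × ℕ)) (i : ℕ) =>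
    show ∃ m, (i, m) ∉ E F from by
      obtain ⟨m, hm⟩ := Infinite.exists_notMem_finset ((E F).image Prod.snd)
      exact ⟨m, fun h => hm (Finset.mem_image_of_mem Prod.snd h)⟩
  let F : ℕ → Finset (ℕ × ℕ) := fun k =>
    Nat.rec ∅ (fun k F => insert (k.unpair.1, μ F k.unpair.1) F) k
  have hF_succ (k : ℕ) : F (k + 1) = insert (k.unpair.1, μ (F k) k.unpair.1) (F k) := rfl
  have hF_mono : Monotone F := monotone_nat_of_le_succ fun k => by
    rw [hF_succ]; exact Finset.subset_insert _ _
  have hF_notMem (k : ℕ) : (k.unpair.1, μ (F k) k.unpair.1) ∉ E (F k) := hμ _ _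
  have hF_card (k : ℕ) : (F k).card = k := by
    induction k with
    | zero => rfl
    | succ k ih => rw [hF_succ, Finset.card_insert_of_notMem fun h => hF_notMem k (hE_self _ h), ih]
  have hdisj {j : ℕ × ℕ} {k l : ℕ} (hl : j ∈ F l) (hk : j ∈ E (F k)) : j ∈ F k := by
    induction l with
    | zero => simp [F] at hl
    | succ l ih =>
      rw [hF_succ, Finset.mem_insert] at hl
      rcases hl with rfl | hl
      · rcases le_or_gt k l with hkl | hkl
        · exact absurd (hE_mono (hF_mono hkl) hk) (hF_notMem l)
        · refine hF_mono hkl ?_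
          rw [Nat.succ_eq_add_one, hF_succ]
          exact Finset.mem_insert_self _ _
      · exact ih hl
  refine ⟨x, {j | ∃ k, j ∈ F k}, fun i => ?_, fun T hT => ⟨hDR ?_, hS₀ _ ?_⟩⟩
  · let g : ℕ → ℕ := fun n => μ (F (Nat.pair i n)) i
    have hg (n : ℕ) : (i, g n) ∈ F (Nat.pair i n + 1) := by
      rw [hF_succ, Nat.unpair_pair]; exact Finset.mem_insert_self _ _
    have hg' (n : ℕ) : (i, g n) ∉ F (Nat.pair i n) := fun h => hμ _ _ (hE_self _ h)
    refine infinite_of_injective_forall_mem (f := g) ?_ fun n =>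
      ⟨Nat.pair i n + 1, hg n⟩
    refine Function.Injective.of_lt_imp_ne fun m n hmn h => hg' n ?_
    rw [← h]
    exact hF_mono (Nat.pair_lt_pair_right i hmn) (hg m)
  · refine mem_iInter.2 fun n => ?_
    refine hS ((F n).filter (· ∈ T)) n _ fun j hj => flipOn_apply_congr ?_ rfl
    have hjE := hE_S (Finset.filter_subset _ (F n)) (hF_card n).ge hj
    simp only [Finset.coe_filter, mem_ofPred_eq]
    refine ⟨fun hjT => ⟨?_, hjT⟩, fun h => h.2⟩
    obtain ⟨l, hl⟩ := hT hjT
    exact hdisj hl hjE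
  · intro j hj
    refine flipOn_apply_of_notMem fun hjT => ?_
    obtain ⟨l, hl⟩ := hT hjT
    simpa [F] using hdisj (k := 0) hl (hE_base _ hj)

/-- If countably many Borel sets cover `(2^ω)^ℕ`, then one of them contains a product of Silver
cubes. -/
lemma exists_isCubeMap_of_iUnion_eq_univ {C : ℕ → Set (ℕ → ℕ → Bool)}
    (hC : ∀ n, MeasurableSet (C n)) (hcov : ⋃ n, C n = univ) :
    ∃ (n : ℕ) (ψ : ℕ → (ℕ → Bool) → (ℕ → Bool)), (∀ i, IsCubeMap (ψ i)) ∧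
      ∀ z : ℕ → ℕ → Bool, (fun i => ψ i (z i)) ∈ C n := by
  have hcurry : Continuous (Function.curry : (ℕ × ℕ → Bool) → ℕ → ℕ → Bool) :=
    continuous_pi fun i => continuous_pi fun j => continuous_apply (i, j)
  choose U hUo hU using fun n => (hcurry.measurable (hC n)).residualEq_isOpen
  obtain ⟨n, hn⟩ : ∃ n, (U n).Nonempty := by
    by_contra! h
    have hres : ⋂ n, {x | x ∉ Function.curry ⁻¹' C n} ∈ residual (ℕ × ℕ → Bool) := by
      refine countable_iInter_mem.2 fun n => ?_
      filter_upwards [(hU n).mem_iff] with x hx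
      simp [hx, h n]
    obtain ⟨x, hx⟩ := (dense_of_mem_residual hres).nonempty
    obtain ⟨n, hn⟩ := mem_iUnion.1 (hcov.ge (mem_univ (Function.curry x)))
    exact mem_iInter.1 hx n hn
  obtain ⟨x, H, hH, hxH⟩ := exists_flipOn_mem_residual (hU n).mem_iff (hUo n) hn
  choose ψ hψ hψT using fun i => exists_isCubeMap_flipOn (fun m => x (i, m)) (hH i)
  refine ⟨n, ψ, hψ, fun z => ?_⟩
  choose T hTH hT using fun i => hψT i (z i)
  obtain ⟨h₁, h₂⟩ := hxH {p | p.2 ∈ T p.1} fun p hp => hTH p.1 hp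
  have hψz : (fun i => ψ i (z i)) = Function.curry (flipOn {p | p.2 ∈ T p.1} x) :=
    funext fun i => hT i
  rw [hψz]
  exact h₁.2 h₂

/-! ### Silver-positive sets -/

lemma not_silverPositive_of_independent {A : Set (ℕ → Bool)} (hA : MeasurableSet A)
    (h : ∀ x ∈ A, ∀ y ∈ A, ¬ SilverAdj x y) : ¬ SilverPositive A :=
  not_not.2 ⟨fun _ => A, fun _ => hA, fun _ => h, fun _ hx => mem_iUnion.2 ⟨0, hx⟩⟩

lemma SilverPositive.nonempty {A : Set (ℕ → Bool)} (hA : SilverPositive A) : A.Nonempty := by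
  by_contra! h
  subst h
  exact not_silverPositive_of_independent MeasurableSet.empty (by simp) hA

lemma SilverPositive.exists_of_subset_iUnion {ι : Type*} [Countable ι] {A : Set (ℕ → Bool)}
    (hA : SilverPositive A) {E : ι → Set (ℕ → Bool)} (h : A ⊆ ⋃ i, E i) :
    ∃ i, SilverPositive (E i) := by
  by_contra! hE
  choose D hDm hDi hD using fun i => not_not.1 (hE i)
  obtain ⟨x, hx⟩ := hA.nonempty
  obtain ⟨i₀, -⟩ := mem_iUnion.1 (h hx)
  have : Nonempty ι := ⟨i₀⟩
  obtain ⟨f, hf⟩ := exists_surjective_nat (ι × ℕ)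
  refine hA ⟨fun n => D (f n).1 (f n).2, fun n => hDm _ _, fun n => hDi _ _, fun y hy => ?_⟩
  obtain ⟨i, hi⟩ := mem_iUnion.1 (h hy)
  obtain ⟨m, hm⟩ := mem_iUnion.1 (hD i hi)
  obtain ⟨n, hn⟩ := hf (i, m)
  exact mem_iUnion.2 ⟨n, by rwa [hn]⟩

lemma IsCubeMap.silverPositive_range {φ : (ℕ → Bool) → (ℕ → Bool)} (hφ : IsCubeMap φ) :
    SilverPositive (range φ) := by
  rintro ⟨D, hDm, hDi, hD⟩
  obtain ⟨n, ψ, hψ, hC⟩ := exists_isCubeMap_of_iUnion_eq_univ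
    (C := fun n => {x | φ (x 0) ∈ D n})
    (fun n => (hφ.1.comp (continuous_apply 0)).measurable (hDm n))
    (eq_univ_of_forall fun x => by simpa using hD (mem_range_self (x 0)))
  have hmem (z : ℕ → Bool) : φ (ψ 0 z) ∈ D n := hC fun _ => z
  exact hDi n _ (hmem fun _ => false) _ (hmem _)
    (hφ.2 _ _ ((hψ 0).2 _ _ (silverAdj_flipOn_singleton 0 _)))

/-- A positive Borel set can be shrunk so as to be contained in one piece of each of finitely many
countable Borel covers. -/
lemma SilverPositive.exists_subset_pieces {ι κ : Type*} [Countable ι] {A : Set (ℕ → Bool)}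
    (hA : SilverPositive A) (hAm : MeasurableSet A) {Q : κ → ι → Set (ℕ → Bool)}
    {s : Set κ} (hs : s.Finite) (hQm : ∀ k i, MeasurableSet (Q k i))
    (hQ : ∀ k ∈ s, A ⊆ ⋃ i, Q k i) :
    ∃ A' ⊆ A, MeasurableSet A' ∧ SilverPositive A' ∧ ∀ k ∈ s, ∃ i, A' ⊆ Q k i := by
  induction s, hs using Set.Finite.induction_on with
  | empty => exact ⟨A, le_rfl, hAm, hA, by simp⟩
  | @insert k s _ _ ih =>
    obtain ⟨A', hA'A, hA'm, hA', h⟩ := ih fun k hk => hQ k (mem_insert_of_mem _ hk)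
    obtain ⟨i, hi⟩ := hA'.exists_of_subset_iUnion (E := fun i => A' ∩ Q k i) (by
      rw [← inter_iUnion]
      exact subset_inter le_rfl (hA'A.trans (hQ k (mem_insert _ _))))
    refine ⟨A' ∩ Q k i, inter_subset_left.trans hA'A, hA'm.inter (hQm k i), hi, ?_⟩
    rintro l (rfl | hl)
    · exact ⟨i, inter_subset_right⟩
    · exact (h l hl).imp fun _ => inter_subset_left.trans

lemma SilverPositive.exists_inter_flipOn {A : Set (ℕ → Bool)} (hA : SilverPositive A)
    (hAm : MeasurableSet A) : ∃ n, SilverPositive (A ∩ flipOn {n} ⁻¹' A) := by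
  have hm (n : ℕ) : MeasurableSet (flipOn {n} ⁻¹' A) := (continuous_flipOn _).measurable hAm
  obtain ⟨_ | n, hn⟩ := hA.exists_of_subset_iUnion (ι := Option ℕ)
    (E := fun o => o.elim (A \ ⋃ n, flipOn {n} ⁻¹' A) fun n => A ∩ flipOn {n} ⁻¹' A) (by
      intro x hx
      by_cases h : x ∈ ⋃ n, flipOn {n} ⁻¹' A
      · obtain ⟨n, hn⟩ := mem_iUnion.1 h
        exact mem_iUnion.2 ⟨some n, hx, hn⟩
      · exact mem_iUnion.2 ⟨none, hx, h⟩)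
  · refine absurd hn (not_silverPositive_of_independent (hAm.diff (MeasurableSet.iUnion hm)) ?_)
    rintro x ⟨-, hx⟩ y ⟨hy, -⟩ hxy
    obtain ⟨n, rfl⟩ := hxy.exists_flipOn
    exact hx (mem_iUnion.2 ⟨n, hy⟩)
  · exact ⟨n, hn⟩

/-- A Borel set admits countable Borel covers such that limits of sequences which eventually stay
in a prescribed piece of each cover belong to the set. -/
lemma MeasurableSet.exists_complete_covers {α : Type*} [TopologicalSpace α] [PolishSpace α]
    [MeasurableSpace α] [BorelSpace α] {B : Set α} (hB : MeasurableSet B) :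
    ∃ P : ℕ → ℕ → Set α, (∀ k i, MeasurableSet (P k i)) ∧ (∀ k, B ⊆ ⋃ i, P k i) ∧
      ∀ (c : ℕ → ℕ) (u : ℕ → α) (x : α), (∀ k l, k ≤ l → u l ∈ P k (c k)) →
        Tendsto u atTop (𝓝 x) → x ∈ B := by
  obtain ⟨X, _, _, g, hg, hgi, rfl⟩ : ∃ (X : Type _) (_ : TopologicalSpace X) (_ : PolishSpace X)
      (g : X → α), Continuous g ∧ Function.Injective g ∧ range g = B := by
    obtain ⟨t, hle, ht, hcl, -⟩ := hB.isClopenable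
    exact ⟨B, @instTopologicalSpaceSubtype _ _ t, @IsClosed.polishSpace _ t ht _ hcl, Subtype.val,
      continuous_le_rng hle (@continuous_subtype_val _ t _), Subtype.val_injective,
      Subtype.range_coe⟩
  rcases isEmpty_or_nonempty X with hX | hX
  · exact ⟨fun _ _ => ∅, by simp, by simp [range_eq_empty],
      fun c u x h => absurd (h 0 0 le_rfl) (notMem_empty _)⟩
  let := TopologicalSpace.upgradeIsCompletelyMetrizable X
  borelize X
  refine ⟨fun k i => g '' Metric.closedBall (TopologicalSpace.denseSeq X i) ((1 / 2) ^ k),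
    fun k i => ?_, fun k => ?_, fun c u x hu hux => ?_⟩
  · exact Metric.isClosed_closedBall.measurableSet.image_of_continuousOn_injOn hg.continuousOn
      hgi.injOn
  · rintro _ ⟨v, rfl⟩
    obtain ⟨i, hi⟩ := (TopologicalSpace.denseRange_denseSeq X).exists_dist_lt v
      (show (0 : ℝ) < (1 / 2) ^ k by positivity)
    exact mem_iUnion.2 ⟨i, v, Metric.mem_closedBall.2 hi.le, rfl⟩
  · choose v hv hvu using fun l => hu l l le_rfl
    have hball (k l : ℕ) (hkl : k ≤ l) :
        v l ∈ Metric.closedBall (TopologicalSpace.denseSeq X (c k)) ((1 / 2) ^ k) := by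
      obtain ⟨w, hw, hwu⟩ := hu k l hkl
      rwa [hgi ((hvu l).trans hwu.symm)]
    have hcauchy : CauchySeq v := by
      refine cauchySeq_of_le_geometric (1 / 2) 2 (by norm_num) fun n => ?_
      have h₁ := Metric.mem_closedBall.1 (hball n n le_rfl)
      have h₂ := Metric.mem_closedBall.1 (hball n (n + 1) n.le_succ)
      linarith [dist_triangle_right (v n) (v (n + 1)) (TopologicalSpace.denseSeq X (c n))]
    obtain ⟨w, hw⟩ := cauchySeq_tendsto_of_complete hcauchy
    have hgw : Tendsto u atTop (𝓝 (g w)) := by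
      simpa only [Function.comp_def, hvu] using (hg.tendsto w).comp hw
    exact ⟨w, tendsto_nhds_unique hgw hux⟩

/-- The conditions of the fusion argument below: `A` is a positive Borel set whose flips on subsets
of `F` remain inside `B`. -/
structure IsFusionCondition (B A : Set (ℕ → Bool)) (F : Finset ℕ) : Prop where
  measurableSet : MeasurableSet A
  silverPositive : SilverPositive A
  flipOn_mem : ∀ T ⊆ (F : Set ℕ), ∀ x ∈ A, flipOn T x ∈ B
  eq_on : ∀ m ∈ F, ∀ x ∈ A, ∀ y ∈ A, x m = y m

lemma IsFusionCondition.exists_extension {B A : Set (ℕ → Bool)} {F : Finset ℕ}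
    (h : IsFusionCondition B A F) {P : ℕ → Set (ℕ → Bool)} (hPm : ∀ i, MeasurableSet (P i))
    (hP : B ⊆ ⋃ i, P i) (k : ℕ) :
    ∃ A' F', IsFusionCondition B A' F' ∧ F ⊂ F' ∧
      (∀ T : Set ℕ, ∀ x ∈ A', ∃ y ∈ A, flipOn (T ∩ F') x = flipOn (T ∩ F) y) ∧
      (∀ T ⊆ (F' : Set ℕ), ∃ i, ∀ x ∈ A', flipOn T x ∈ P i) ∧
      ∀ m ≤ k, ∀ x ∈ A', ∀ y ∈ A', x m = y m := by
  obtain ⟨n, hn⟩ := h.silverPositive.exists_inter_flipOn h.measurableSet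
  have hnF : n ∉ F := by
    intro hnF
    obtain ⟨x, hx, hx'⟩ := hn.nonempty
    simpa [flipOn] using h.eq_on n hnF x hx _ hx'
  have hflip (T : Set ℕ) (x : ℕ → Bool) (hx : x ∈ A ∩ flipOn {n} ⁻¹' A) :
      ∃ y ∈ A, flipOn (T ∩ (insert n F : Finset ℕ)) x = flipOn (T ∩ F) y := by
    by_cases hnT : n ∈ T
    · refine ⟨flipOn {n} x, hx.2, ?_⟩
      rw [flipOn_flipOn_of_disjoint (by simp [hnF]), Finset.coe_insert, inter_insert_of_mem hnT,
        union_singleton]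
    · exact ⟨x, hx.1, by rw [Finset.coe_insert, inter_insert_of_notMem hnT]⟩
  have hB (T : Set ℕ) (hT : T ⊆ (insert n F : Finset ℕ)) (x : ℕ → Bool)
      (hx : x ∈ A ∩ flipOn {n} ⁻¹' A) : flipOn T x ∈ B := by
    obtain ⟨y, hy, hxy⟩ := hflip T x hx
    rw [inter_eq_left.2 hT] at hxy
    exact hxy ▸ h.flipOn_mem _ inter_subset_right y hy
  obtain ⟨A₁, hA₁, hA₁m, hA₁p, hA₁P⟩ := hn.exists_subset_pieces
    (h.measurableSet.inter ((continuous_flipOn _).measurable h.measurableSet))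
    (Q := fun (T : Set ℕ) i => flipOn T ⁻¹' P i) (insert n F).finite_toSet.finite_subsets
    (fun T i => (continuous_flipOn T).measurable (hPm i)) (fun T hT x hx => by
      simpa using hP (hB T hT x hx))
  obtain ⟨A₂, hA₂, hA₂m, hA₂p, hA₂c⟩ := hA₁p.exists_subset_pieces hA₁m
    (Q := fun (m : ℕ) (b : Bool) => {x | x m = b})
    ((insert n F).finite_toSet.union (finite_Iic k))
    (fun m b => measurableSet_eq_fun (measurable_pi_apply m) measurable_const)
    (fun m _ x _ => by simp)
  have hconst (m : ℕ) (hm : m ∈ ((insert n F : Finset ℕ) : Set ℕ) ∪ Iic k) :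
      ∀ x ∈ A₂, ∀ y ∈ A₂, x m = y m := by
    obtain ⟨b, hb⟩ := hA₂c m hm
    exact fun x hx y hy => (hb hx).trans (hb hy).symm
  refine ⟨A₂, insert n F, ⟨hA₂m, hA₂p, fun T hT x hx => hB T hT x (hA₁ (hA₂ hx)),
    fun m hm => hconst m (Or.inl hm)⟩, Finset.ssubset_insert hnF,
    fun T x hx => hflip T x (hA₁ (hA₂ hx)), fun T hT => ?_, fun m hm => hconst m (Or.inr hm)⟩
  exact (hA₁P T hT).imp fun i hi x hx => hi (hA₂ hx)

/-- Silver-positive Borel sets contain Silver cubes. -/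
lemma SilverPositive.exists_isCubeMap {B : Set (ℕ → Bool)} (hB : SilverPositive B)
    (hBm : MeasurableSet B) : ∃ φ, IsCubeMap φ ∧ ∀ z, φ z ∈ B := by
  have : PolishSpace (ℕ → Bool) := {}
  obtain ⟨P, hPm, hPB, hP⟩ := hBm.exists_complete_covers
  let State := {p : Set (ℕ → Bool) × Finset ℕ // IsFusionCondition B p.1 p.2}
  choose nextA nextF hnext hssub hshrink hpiece hconst using
    fun (k : ℕ) (p : State) => p.2.exists_extension (hPm k) (hPB k) k
  let s : ℕ → State := fun k => Nat.rec
    ⟨(B, ∅), hBm, hB, fun T hT x hx => by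
      rw [subset_eq_empty hT Finset.coe_empty, flipOn_empty]; exact hx, by simp⟩
    (fun k p => ⟨(nextA k p, nextF k p), hnext k p⟩) k
  let A : ℕ → Set (ℕ → Bool) := fun k => (s k).1.1
  let F : ℕ → Finset ℕ := fun k => (s k).1.2
  have hF_lt : StrictMono F := strictMono_nat_of_lt_succ fun k => hssub k (s k)
  have hA_shrink (T : Set ℕ) {k l : ℕ} (hkl : k ≤ l) :
      ∀ x ∈ A l, ∃ y ∈ A k, flipOn (T ∩ F l) x = flipOn (T ∩ F k) y := by
    induction l, hkl using Nat.le_induction with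
    | base => exact fun x hx => ⟨x, hx, rfl⟩
    | succ l _ ih =>
      intro x hx
      obtain ⟨y, hy, hxy⟩ := hshrink l (s l) T x hx
      obtain ⟨w, hw, hyw⟩ := ih y hy
      exact ⟨w, hw, hxy.trans hyw⟩
  have hA_anti {k l : ℕ} (hkl : k ≤ l) : A l ⊆ A k := fun x hx => by
    obtain ⟨y, hy, hxy⟩ := hA_shrink ∅ hkl x hx
    simp only [empty_inter, flipOn_empty] at hxy
    rwa [hxy]
  choose a ha using fun k => (s k).2.silverPositive.nonempty
  have ha_const {m l : ℕ} (hml : m ≤ l) : a (l + 1) m = a (m + 1) m :=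
    hconst m (s m) m le_rfl _ (hA_anti (Nat.succ_le_succ hml) (ha (l + 1))) _ (ha (m + 1))
  have hH : (⋃ k, (F k : Set ℕ)).Infinite := by
    intro hfin
    have hsub (k : ℕ) : F k ⊆ hfin.toFinset := fun m hm => by
      rw [Set.Finite.mem_toFinset]; exact mem_iUnion.2 ⟨k, hm⟩
    have h₁ := Finset.card_le_card (hsub (hfin.toFinset.card + 1))
    have h₂ := (Finset.card_strictMono.comp hF_lt).id_le (hfin.toFinset.card + 1)
    simp only [id, Function.comp] at h₂
    omega
  obtain ⟨φ, hφ, hφT⟩ := exists_isCubeMap_flipOn (fun m => a (m + 1) m) hH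
  refine ⟨φ, hφ, fun z => ?_⟩
  obtain ⟨T, hTH, hT⟩ := hφT z
  rw [hT]
  choose c hc using fun k => hpiece k (s k) (T ∩ F (k + 1)) inter_subset_right
  refine hP c (fun l => flipOn (T ∩ F (l + 1)) (a (l + 1))) _ (fun k l hkl => ?_)
    (tendsto_pi_nhds.2 fun m => tendsto_nhds_of_eventually_eq ?_)
  · obtain ⟨y, hy, hxy⟩ := hA_shrink T (Nat.succ_le_succ hkl) _ (ha (l + 1))
    simp only [hxy]
    exact hc k y hy
  · obtain ⟨k, hk⟩ : ∃ k, m ∈ T → m ∈ F k := by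
      by_cases hm : m ∈ T
      · exact (mem_iUnion.1 (hTH hm)).imp fun _ h _ => h
      · exact ⟨0, fun h => absurd h hm⟩
    filter_upwards [eventually_ge_atTop k, eventually_ge_atTop m] with l hkl hml
    refine flipOn_apply_congr ⟨fun h => h.1, fun h => ⟨h, ?_⟩⟩ (ha_const hml)
    exact hF_lt.monotone (hkl.trans l.le_succ) (hk h)

/-- Countable-dimensional rectangular Ramsey property `MRR(I, I, I, ...)` for
the Silver ideal `I`. -/
theorem mrr_silver_ideal_product
    (B : ℕ → Set (ℕ → Bool))
    (hBmeas : ∀ i, MeasurableSet (B i))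
    (hBpos : ∀ i, SilverPositive (B i))
    (C : ℕ → Set (ℕ → (ℕ → Bool)))
    (hCmeas : ∀ n, MeasurableSet (C n))
    (hcov : {x : ℕ → (ℕ → Bool) | ∀ i, x i ∈ B i} ⊆ ⋃ n, C n) :
    ∃ (n : ℕ) (B' : ℕ → Set (ℕ → Bool)),
      (∀ i, MeasurableSet (B' i)) ∧ (∀ i, SilverPositive (B' i)) ∧
      (∀ i, B' i ⊆ B i) ∧
      {x : ℕ → (ℕ → Bool) | ∀ i, x i ∈ B' i} ⊆ C n := by
  choose φ hφ hφB using fun i => (hBpos i).exists_isCubeMap (hBmeas i)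
  have hcont : Continuous fun (x : ℕ → ℕ → Bool) i => φ i (x i) :=
    continuous_pi fun i => (hφ i).1.comp (continuous_apply i)
  obtain ⟨n, ψ, hψ, hC⟩ := exists_isCubeMap_of_iUnion_eq_univ
    (C := fun n => {x : ℕ → ℕ → Bool | (fun i => φ i (x i)) ∈ C n})
    (fun n => hcont.measurable (hCmeas n))
    (eq_univ_of_forall fun x => by
      simpa using hcov (show (fun i => φ i (x i)) ∈ _ from fun i => hφB i (x i)))
  have hcomp (i : ℕ) : IsCubeMap (φ i ∘ ψ i) := (hφ i).comp (hψ i)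
  refine ⟨n, fun i => range (φ i ∘ ψ i), fun i => (hcomp i).measurableSet_range,
    fun i => (hcomp i).silverPositive_range, ?_, fun x hx => ?_⟩
  · rintro i _ ⟨z, rfl⟩
    exact hφB i _
  · choose z hz using hx
    rw [← funext hz]
    exact hC z
end
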